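/- arXiv:1902.01785 — 4 statements merged into one kernel-verified Lean document; each statement's English description precedes it below -/
import Mathlib

section
/- Let A be a real m×d matrix and b ∈ ℝ^m. Then there exist finitely many points v_1,…,v_n ∈ ℝ^d and finitely many rays r_1,…,r_s ∈ ℝ^d such that the convex polyhedron { z ∈ ℝ^d | A z ≤ b } equals the Minkowski sum conv(v_1,…,v_n) + cone(r_1,…,r_s), i.e. the set of all points Σ_i λ_i v_i + Σ_j μ_j r_j with λ_i ≥ 0, μ_j ≥ 0, and Σ_i λ_i = 1. -/
open scoped NNReal

namespace MW

variable {V : Type*} [AddCommGroup V] [Module ℝ V]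

theorem smul_mem' (D : Submodule ℝ≥0 V) {c : ℝ} (hc : 0 ≤ c) {x : V} (hx : x ∈ D) : c • x ∈ D :=
  D.smul_mem (⟨c, hc⟩ : ℝ≥0) hx

theorem finite_real : Module.Finite ℝ≥0 ℝ := by
  refine ⟨⟨{1, -1}, ?_⟩⟩
  rw [eq_top_iff]
  intro x _
  rcases le_total 0 x with h | h
  · have h1 : (1 : ℝ) ∈ Submodule.span ℝ≥0 ((({1, -1} : Finset ℝ)) : Set ℝ) :=
      Submodule.subset_span (by simp)
    simpa using smul_mem' _ h h1
  · have h1 : (-1 : ℝ) ∈ Submodule.span ℝ≥0 ((({1, -1} : Finset ℝ)) : Set ℝ) :=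
      Submodule.subset_span (by simp)
    simpa using smul_mem' _ (neg_nonneg.2 h) h1

/-- The half-space cone. -/
def half (f : V →ₗ[ℝ] ℝ) : Submodule ℝ≥0 V where
  carrier := {x | f x ≤ 0}
  add_mem' := by
    intro a b ha hb
    simp only [Set.mem_ofPred_eq, map_add] at *
    linarith
  zero_mem' := by simp
  smul_mem' := by
    intro c x hx
    simp only [Set.mem_ofPred_eq, NNReal.smul_def, map_smul, smul_eq_mul] at *
    exact mul_nonpos_of_nonneg_of_nonpos c.2 hx

theorem mem_half (f : V →ₗ[ℝ] ℝ) (x : V) : x ∈ half f ↔ f x ≤ 0 := Iff.rfl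

theorem fg_inf_half (C : Submodule ℝ≥0 V) (hC : C.FG) (f : V →ₗ[ℝ] ℝ) : (C ⊓ half f).FG := by
  classical
  obtain ⟨S, rfl⟩ := hC
  set P : Finset V := S.filter (fun x => 0 < f x) with hP
  set N : Finset V := S.filter (fun x => ¬ 0 < f x) with hN
  set M : Finset V := (P ×ˢ N).image (fun q => f q.1 • q.2 - f q.2 • q.1) with hM
  refine ⟨N ∪ M, ?_⟩
  set D := Submodule.span ℝ≥0 ((N ∪ M : Finset V) : Set V) with hD
  have hND : Submodule.span ℝ≥0 (N : Set V) ≤ D := Submodule.span_mono (by simp)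
  have bil : ∀ u ∈ Submodule.span ℝ≥0 (P : Set V), ∀ w ∈ Submodule.span ℝ≥0 (N : Set V),
      f u • w - f w • u ∈ D := by
    intro u hu w hw
    induction hu using Submodule.span_induction with
    | mem u hu =>
      induction hw using Submodule.span_induction with
      | mem w hw =>
        apply Submodule.subset_span
        rw [Finset.coe_union]
        right
        rw [hM]
        exact Finset.mem_coe.2 (Finset.mem_image.2 ⟨(u, w), Finset.mem_product.2 ⟨hu, hw⟩, rfl⟩)
      | zero => simp
      | add a b _ _ ha hb =>
        convert D.add_mem ha hb using 1
        simp only [map_add]; module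
      | smul c a _ ha =>
        convert D.smul_mem c ha using 1
        simp only [NNReal.smul_def, map_smul, smul_eq_mul]; module
    | zero => simp
    | add a b _ _ ha hb =>
      convert D.add_mem ha hb using 1
      simp only [map_add]; module
    | smul c a _ ha =>
      convert D.smul_mem c ha using 1
      simp only [NNReal.smul_def, map_smul, smul_eq_mul]; module
  have pos : ∀ u ∈ Submodule.span ℝ≥0 (P : Set V), u = 0 ∨ 0 < f u := by
    intro u hu
    induction hu using Submodule.span_induction with
    | mem u hu => right; exact (Finset.mem_filter.1 hu).2
    | zero => simp
    | add a b _ _ ha hb =>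
      rcases ha with rfl | ha
      · simpa using hb
      · rcases hb with rfl | hb
        · simpa using Or.inr ha
        · right; rw [map_add]; linarith
    | smul c a _ ha =>
      rcases ha with rfl | ha
      · simp
      · rcases eq_or_ne c 0 with rfl | hc
        · simp
        · right
          simp only [NNReal.smul_def, map_smul, smul_eq_mul]
          have : (0 : ℝ) < c := by exact_mod_cast pos_iff_ne_zero.2 hc
          positivity
  have neg : Submodule.span ℝ≥0 (N : Set V) ≤ half f := by
    rw [Submodule.span_le]
    intro x hx
    exact not_lt.1 (Finset.mem_filter.1 hx).2
  apply le_antisymm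
  · rw [hD, Submodule.span_le]
    intro x hx
    rw [Finset.coe_union] at hx
    rcases hx with hx | hx
    · exact ⟨Submodule.subset_span (Finset.mem_filter.1 hx).1,
        not_lt.1 (Finset.mem_filter.1 hx).2⟩
    · obtain ⟨⟨p, n⟩, hpn, rfl⟩ := Finset.mem_image.1 (Finset.mem_coe.1 hx)
      obtain ⟨hp, hn⟩ := Finset.mem_product.1 hpn
      obtain ⟨hp, hp'⟩ := Finset.mem_filter.1 hp
      obtain ⟨hn, hn'⟩ := Finset.mem_filter.1 hn
      simp only at hp hp' hn hn'
      refine ⟨?_, ?_⟩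
      · have h1 := smul_mem' (Submodule.span ℝ≥0 (S : Set V)) hp'.le (Submodule.subset_span hn)
        have h2 := smul_mem' (Submodule.span ℝ≥0 (S : Set V)) (c := - f n) (by linarith)
          (Submodule.subset_span hp)
        have h3 : f p • n - f n • p = f p • n + (-f n) • p := by module
        rw [SetLike.mem_coe]
        show f p • n - f n • p ∈ _
        rw [h3]
        exact Submodule.add_mem _ h1 h2
      · show f (f p • n - f n • p) ≤ 0
        simp only [map_sub, map_smul, smul_eq_mul]
        linarith [mul_comm (f p) (f n)]
  · rintro x ⟨hx, hfx⟩
    have hS : (S : Set V) = (P : Set V) ∪ N := by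
      rw [← Finset.coe_union, hP, hN, Finset.filter_union_filter_not_eq]
    rw [SetLike.mem_coe, hS, Submodule.span_union] at hx
    obtain ⟨u, hu, w, hw, rfl⟩ := Submodule.mem_sup.1 hx
    have hfx' : f u + f w ≤ 0 := by simpa [mem_half] using hfx
    have hw0 : f w ≤ 0 := neg hw
    rcases pos u hu with rfl | hu0
    · simpa using hND hw
    · have hw1 : 0 < - f w := by linarith
      have h1 := D.add_mem (bil u hu w hw)
        (smul_mem' D (c := -(f u + f w)) (by linarith) (hND hw))
      have h2 := smul_mem' D (inv_nonneg.2 hw1.le) h1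
      convert h2 using 1
      rw [eq_inv_smul_iff₀ hw1.ne']
      module

theorem fg_all [Module.Finite ℝ≥0 V] {m : ℕ} (f : Fin m → V →ₗ[ℝ] ℝ) :
    ∃ C : Submodule ℝ≥0 V, C.FG ∧ ∀ x, x ∈ C ↔ ∀ i, f i x ≤ 0 := by
  induction m with
  | zero => exact ⟨⊤, Module.Finite.fg_top, by simp⟩
  | succ k ih =>
    obtain ⟨C, hC, h⟩ := ih (fun i => f i.succ)
    refine ⟨C ⊓ half (f 0), fg_inf_half C hC _, fun x => ?_⟩
    rw [Submodule.mem_inf, h, mem_half, Fin.forall_fin_succ, and_comm]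

end MW

theorem MW.general (m d : ℕ) (A : Matrix (Fin m) (Fin d) ℝ) (b : Fin m → ℝ) :
    ∃ (ι κ : Type) (_ : Fintype ι) (_ : Fintype κ) (v : ι → (Fin d → ℝ)) (r : κ → (Fin d → ℝ)),
      ∀ z : Fin d → ℝ, A.mulVec z ≤ b ↔ ∃ (lam : ι → ℝ) (mu : κ → ℝ),
          (∀ i, 0 ≤ lam i) ∧ (∀ j, 0 ≤ mu j) ∧ (∑ i, lam i) = 1 ∧
          z = (∑ i, lam i • v i) + (∑ j, mu j • r j) := by
  classical
  haveI := MW.finite_real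
  obtain ⟨C, hC, hmem⟩ := MW.fg_all (V := (Fin d → ℝ) × ℝ) (m := m + 1)
    (Fin.cons (-(LinearMap.snd ℝ (Fin d → ℝ) ℝ))
      (fun i => (LinearMap.proj i ∘ₗ A.mulVecLin) ∘ₗ LinearMap.fst ℝ (Fin d → ℝ) ℝ
        - b i • LinearMap.snd ℝ (Fin d → ℝ) ℝ))
  have hmem' : ∀ x : (Fin d → ℝ) × ℝ, x ∈ C ↔ 0 ≤ x.2 ∧ ∀ i, A.mulVec x.1 i ≤ b i * x.2 := by
    intro x
    rw [hmem, Fin.forall_fin_succ]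
    simp
  obtain ⟨k, g, hg⟩ := Submodule.fg_iff_exists_fin_generating_family.1 hC
  have hpos : ∀ i, 0 ≤ (g i).2 := fun i =>
    ((hmem' _).1 (hg ▸ Submodule.subset_span ⟨i, rfl⟩)).1
  refine ⟨{i : Fin k // 0 < (g i).2}, {i : Fin k // ¬ 0 < (g i).2}, inferInstance, inferInstance,
    fun i => ((g i).2)⁻¹ • (g i).1, fun i => (g i).1, fun z => ?_⟩
  have h0 : A.mulVec z ≤ b ↔ (z, (1 : ℝ)) ∈ C := by
    rw [hmem']; simp [Pi.le_def]
  rw [h0]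
  constructor
  · intro hz
    rw [← hg, Submodule.mem_span_range_iff_exists_fun] at hz
    obtain ⟨c, hc⟩ := hz
    have hc1 := congrArg Prod.fst hc
    have hc2 := congrArg Prod.snd hc
    simp only [Prod.fst_sum, Prod.snd_sum, Prod.smul_fst, Prod.smul_snd, NNReal.smul_def] at hc1 hc2
    refine ⟨fun i => c i * (g i).2, fun i => c i, fun i => mul_nonneg (c i).2 (hpos i),
      fun i => (c i).2, ?_, ?_⟩
    · rw [← hc2, ← Fintype.sum_subtype_add_sum_subtype (fun i => 0 < (g i).2)]
      symm
      apply add_eq_left.2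
      apply Finset.sum_eq_zero
      intro i _
      rw [le_antisymm (not_lt.1 i.2) (hpos i)]; simp
    · rw [← hc1, ← Fintype.sum_subtype_add_sum_subtype (fun i => 0 < (g i).2)]
      congr 1
      refine Finset.sum_congr rfl fun i _ => ?_
      rw [smul_smul, mul_assoc, mul_inv_cancel₀ i.2.ne', mul_one]
  · rintro ⟨lam, mu, hl, hm, h1, rfl⟩
    have hgC : ∀ i, g i ∈ C := fun i => hg ▸ Submodule.subset_span ⟨i, rfl⟩
    have key := C.add_mem
      (C.sum_mem (t := Finset.univ) (f := fun i : {i : Fin k // 0 < (g i).2} =>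
        lam i • ((g i).2)⁻¹ • g i)
        (fun i _ => MW.smul_mem' C (hl i) (MW.smul_mem' C (inv_nonneg.2 (hpos i)) (hgC i))))
      (C.sum_mem (t := Finset.univ) (f := fun i : {i : Fin k // ¬ 0 < (g i).2} => mu i • g i)
        (fun i _ => MW.smul_mem' C (hm i) (hgC i)))
    convert key using 1
    ext1
    · simp [Prod.fst_sum]
    · simp only [Prod.snd_add, Prod.snd_sum, Prod.smul_snd, smul_eq_mul]
      rw [← h1]
      symm
      rw [Finset.sum_congr rfl fun i _ => by rw [inv_mul_cancel₀ (Subtype.prop i).ne', mul_one]]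
      apply add_eq_left.2
      apply Finset.sum_eq_zero
      intro i _
      rw [le_antisymm (not_lt.1 i.2) (hpos i), mul_zero]

/-- Minkowski–Weyl decomposition, H-representation to V-representation:
every polyhedron `{z | A z ≤ b}` is the Minkowski sum of a convex hull of
finitely many points and a cone of finitely many rays. -/
theorem minkowski_weyl_H_to_V (m d : ℕ) (A : Matrix (Fin m) (Fin d) ℝ) (b : Fin m → ℝ) :
    ∃ (n s : ℕ) (v : Fin n → (Fin d → ℝ)) (r : Fin s → (Fin d → ℝ)),
      {z : Fin d → ℝ | A.mulVec z ≤ b} =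
        {z : Fin d → ℝ | ∃ (lam : Fin n → ℝ) (mu : Fin s → ℝ),
          (∀ i, 0 ≤ lam i) ∧ (∀ j, 0 ≤ mu j) ∧ (∑ i, lam i) = 1 ∧
          z = (∑ i, lam i • v i) + (∑ j, mu j • r j)} := by
  obtain ⟨ι, κ, _, _, v, r, h⟩ := MW.general m d A b
  let e := Fintype.equivFin ι
  let e' := Fintype.equivFin κ
  refine ⟨Fintype.card ι, Fintype.card κ, v ∘ e.symm, r ∘ e'.symm, ?_⟩
  ext z
  rw [Set.mem_ofPred_eq, Set.mem_ofPred_eq, h]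
  constructor
  · rintro ⟨lam, mu, hl, hm, h1, h2⟩
    refine ⟨lam ∘ e.symm, mu ∘ e'.symm, fun i => hl _, fun i => hm _, ?_, ?_⟩
    · rw [← h1]; exact Equiv.sum_comp e.symm lam
    · rw [h2]
      congr 1
      · exact (Equiv.sum_comp e.symm (fun i => lam i • v i)).symm
      · exact (Equiv.sum_comp e'.symm (fun i => mu i • r i)).symm
  · rintro ⟨lam, mu, hl, hm, h1, h2⟩
    refine ⟨lam ∘ e, mu ∘ e', fun i => hl _, fun i => hm _, ?_, ?_⟩
    · rw [← h1]; exact Equiv.sum_comp e lam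
    · rw [h2, ← Equiv.sum_comp e, ← Equiv.sum_comp e']
      simp
end

section
/- Let v_1,…,v_n ∈ ℝ^d be finitely many points and r_1,…,r_s ∈ ℝ^d finitely many rays. Then there exist an m ∈ ℕ, a real m×d matrix A, and b ∈ ℝ^m such that the Minkowski sum conv(v_1,…,v_n) + cone(r_1,…,r_s) equals { z ∈ ℝ^d | A z ≤ b }. -/
/-- Finite intersection of homogeneous half-spaces. -/
def IsPolyCone {E : Type} [AddCommGroup E] [Module ℝ E] (S : Set E) : Prop :=
  ∃ H : Set (E →ₗ[ℝ] ℝ), H.Finite ∧ ∀ z, z ∈ S ↔ ∀ a ∈ H, a z ≤ 0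

/-- One Fourier–Motzkin elimination step. -/
theorem IsPolyCone.add_ray {E : Type} [AddCommGroup E] [Module ℝ E] {S : Set E}
    (hS : IsPolyCone S) (r : E) :
    IsPolyCone {z : E | ∃ t : ℝ, 0 ≤ t ∧ ∃ w ∈ S, z = w + t • r} := by
  obtain ⟨H, hf, hH⟩ := hS
  refine ⟨{a ∈ H | a r ≤ 0} ∪ Set.image2 (fun p q => (-(q r)) • p + (p r) • q)
    {a ∈ H | 0 < a r} {a ∈ H | a r < 0},
    (hf.sep _).union ((hf.sep _).image2 _ (hf.sep _)), fun z => ?_⟩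
  constructor
  · rintro ⟨t, ht, w, hw, rfl⟩ a ha
    rw [hH] at hw
    rcases ha with ⟨ha, har⟩ | ⟨p, ⟨hp, hpr⟩, q, ⟨hq, hqr⟩, rfl⟩
    · have := hw a ha
      simp only [map_add, map_smul, smul_eq_mul]
      nlinarith
    · have h1 := hw p hp
      have h2 := hw q hq
      simp only [map_add, map_smul, smul_eq_mul, LinearMap.add_apply, LinearMap.smul_apply]
      nlinarith
  · intro h
    obtain ⟨t, htT, hmax⟩ := Set.exists_max_image
      (insert 0 (Set.image (fun p : E →ₗ[ℝ] ℝ => p z / p r) {a ∈ H | 0 < a r})) id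
      (((hf.sep _).image _).insert _) ⟨0, Set.mem_insert _ _⟩
    refine ⟨t, hmax 0 (Set.mem_insert _ _), z - t • r, ?_, by simp⟩
    rw [hH]
    intro a ha
    simp only [map_sub, map_smul, smul_eq_mul]
    rcases lt_or_ge 0 (a r) with har | har
    · have := hmax (a z / a r) (Set.mem_insert_of_mem _ ⟨a, ⟨ha, har⟩, rfl⟩)
      simp only [id] at this
      rw [div_le_iff₀ har] at this
      linarith
    · have haz : a z ≤ 0 := h a (Or.inl ⟨ha, har⟩)
      rcases htT with rfl | ⟨p, ⟨hp, hpr⟩, rfl⟩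
      · simpa using haz
      · rcases har.lt_or_eq with har | har
        · have := h _ (Or.inr ⟨p, ⟨hp, hpr⟩, a, ⟨ha, har⟩, rfl⟩)
          simp only [smul_eq_mul, LinearMap.add_apply, LinearMap.smul_apply] at this
          have h3 : a z - p z / p r * a r = (-(a r) * p z + p r * a z) / p r := by
            field_simp
            ring
          simp only [h3]
          exact div_nonpos_of_nonpos_of_nonneg this hpr.le
        · simp [har, haz]

theorem IsPolyCone.add_rays {E : Type} [AddCommGroup E] [Module ℝ E] {S : Set E}
    (hS : IsPolyCone S) (k : ℕ) (g : Fin k → E) :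
    IsPolyCone {z : E | ∃ c : Fin k → ℝ, (∀ i, 0 ≤ c i) ∧ ∃ w ∈ S, z = w + ∑ i, c i • g i} := by
  induction k with
  | zero => simpa using hS
  | succ k ih =>
    convert (ih (fun i => g i.castSucc)).add_ray (g (Fin.last k)) using 1
    ext z
    constructor
    · rintro ⟨c, hc, w, hw, rfl⟩
      refine ⟨c (Fin.last k), hc _, _, ⟨fun i => c i.castSucc, fun i => hc _, w, hw, rfl⟩, ?_⟩
      rw [Fin.sum_univ_castSucc, add_assoc]
    · rintro ⟨t, ht, _, ⟨c, hc, w, hw, rfl⟩, rfl⟩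
      refine ⟨Fin.snoc c t, fun i => ?_, w, hw, ?_⟩
      · refine Fin.lastCases ?_ (fun i => ?_) i
        · simpa using ht
        · simpa using hc i
      · simp [Fin.sum_univ_castSucc, add_assoc]

theorem isPolyCone_zero (d : ℕ) : IsPolyCone ({0} : Set ((Fin d → ℝ) × ℝ)) := by
  let b := Module.finBasis ℝ ((Fin d → ℝ) × ℝ)
  refine ⟨Set.range (fun i => b.coord i) ∪ Set.range (fun i => -b.coord i),
    (Set.finite_range _).union (Set.finite_range _), fun z => ?_⟩
  constructor
  · rintro rfl a _
    simp
  · intro h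
    rw [Set.mem_singleton_iff, ← b.forall_coord_eq_zero_iff]
    intro i
    have h1 := h _ (Or.inl ⟨i, rfl⟩)
    have h2 := h _ (Or.inr ⟨i, rfl⟩)
    simp only [LinearMap.neg_apply] at h2
    linarith

/-- Minkowski–Weyl decomposition, V-representation to H-representation:
the Minkowski sum of a convex hull of finitely many points and a cone of
finitely many rays is a polyhedron `{z | A z ≤ b}`. -/
theorem minkowski_weyl_V_to_H (d n s : ℕ) (v : Fin n → (Fin d → ℝ)) (r : Fin s → (Fin d → ℝ)) :
    ∃ (m : ℕ) (A : Matrix (Fin m) (Fin d) ℝ) (b : Fin m → ℝ),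
      {z : Fin d → ℝ | ∃ (lam : Fin n → ℝ) (mu : Fin s → ℝ),
          (∀ i, 0 ≤ lam i) ∧ (∀ j, 0 ≤ mu j) ∧ (∑ i, lam i) = 1 ∧
          z = (∑ i, lam i • v i) + (∑ j, mu j • r j)} =
        {z : Fin d → ℝ | A.mulVec z ≤ b} := by
  obtain ⟨H, hf, hH⟩ := ((isPolyCone_zero d).add_rays n (fun i => (v i, (1 : ℝ)))).add_rays s
    (fun j => (r j, (0 : ℝ)))
  have : Finite H := hf
  obtain ⟨m, ⟨e⟩⟩ := Finite.exists_equiv_fin H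
  refine ⟨m, fun i j => (e.symm i).1 (Pi.single j 1, 0), fun i => -(e.symm i).1 (0, 1), ?_⟩
  ext z
  have key : ∀ a : ((Fin d → ℝ) × ℝ) →ₗ[ℝ] ℝ,
      a (z, 1) = (∑ j, a (Pi.single j 1, 0) * z j) + a (0, 1) := by
    intro a
    have h1 : ((z, 1) : (Fin d → ℝ) × ℝ) =
        (∑ j, z j • ((Pi.single j 1, 0) : (Fin d → ℝ) × ℝ)) + (0, 1) := by
      ext k
      · simp [Prod.fst_sum, Finset.sum_apply, Pi.single_apply]
      · simp [Prod.snd_sum]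
    rw [h1, map_add, map_sum]
    simp only [map_smul, smul_eq_mul, mul_comm]
  have hz := hH (z, 1)
  have h2 : (∀ a ∈ H, a (z, 1) ≤ 0) ↔ Matrix.mulVec
      (fun i j => (e.symm i).1 (Pi.single j 1, 0) : Matrix (Fin m) (Fin d) ℝ) z ≤
      fun i => -(e.symm i).1 (0, 1) := by
    constructor
    · intro h i
      have := h _ (e.symm i).2
      rw [key] at this
      simp only [Matrix.mulVec, dotProduct]
      linarith
    · intro h a ha
      have := h (e ⟨a, ha⟩)
      simp only [Matrix.mulVec, dotProduct, Equiv.symm_apply_apply] at this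
      rw [key]
      linarith
  rw [Set.mem_ofPred_eq, Set.mem_ofPred_eq, ← h2, ← hz]
  constructor
  · rintro ⟨lam, mu, hl, hm, h1, rfl⟩
    refine ⟨mu, hm, _, ⟨lam, hl, 0, rfl, rfl⟩, ?_⟩
    ext k
    · simp [Prod.fst_sum]
    · simp [Prod.snd_sum, h1]
  · rintro ⟨mu, hm, _, ⟨lam, hl, _, rfl, rfl⟩, h⟩
    refine ⟨lam, mu, hl, hm, ?_, ?_⟩
    · have := congrArg Prod.snd h
      simp [Prod.snd_sum] at this
      exact this.symm
    · have := congrArg Prod.fst h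
      simpa [Prod.fst_sum] using this
end

section
/- Let A be a real m×d matrix. Then there exist finitely many rays r_1,…,r_s ∈ ℝ^d such that { z ∈ ℝ^d | A z ≤ 0 } = cone(r_1,…,r_s), the set of all conical combinations Σ_j μ_j r_j with μ_j ≥ 0. -/
theorem mw_step {E : Type*} [AddCommGroup E] [Module ℝ E] (f : E →ₗ[ℝ] ℝ)
    (K : PointedCone ℝ E) (hK : K.FG) :
    ∃ L : PointedCone ℝ E, L.FG ∧ ∀ z, z ∈ L ↔ z ∈ K ∧ f z ≤ 0 := by
  classical
  obtain ⟨n, r, rfl⟩ := Submodule.fg_iff_exists_fin_generating_family.1 hK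
  let x : Fin n → E := fun i => if 0 < f (r i) then r i else 0
  let y : Fin n → E := fun i => if 0 < f (r i) then 0 else r i
  have hxy : ∀ i, r i = x i + y i := by
    intro i; simp only [x, y]; split_ifs <;> simp
  have hr : ∀ i, r i ∈ Submodule.span {c : ℝ // 0 ≤ c} (Set.range r) :=
    fun i => Submodule.subset_span ⟨i, rfl⟩
  have hx : ∀ i, x i ∈ Submodule.span {c : ℝ // 0 ≤ c} (Set.range r) := by
    intro i; simp only [x]; split_ifs
    · exact hr i
    · exact zero_mem _
  have hy : ∀ i, y i ∈ Submodule.span {c : ℝ // 0 ≤ c} (Set.range r) := by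
    intro i; simp only [y]; split_ifs
    · exact zero_mem _
    · exact hr i
  have ha : ∀ i, 0 ≤ f (x i) := by
    intro i; simp only [x]; split_ifs with h
    · exact h.le
    · simp
  have ha0 : ∀ i, f (x i) = 0 → x i = 0 := by
    intro i; simp only [x]; split_ifs with h
    · intro h'; exact absurd h' h.ne'
    · simp
  have hb : ∀ i, f (y i) ≤ 0 := by
    intro i; simp only [y]; split_ifs with h
    · simp
    · exact not_lt.1 h
  let g : Fin n ⊕ (Fin n × Fin n) → E :=
    Sum.elim y (fun p => f (x p.1) • y p.2 + (-f (y p.2)) • x p.1)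
  refine ⟨Submodule.span _ (Set.range g), Submodule.fg_span (Set.finite_range g), fun z => ?_⟩
  constructor
  · intro hz
    induction hz using Submodule.span_induction with
    | mem z hz =>
      obtain ⟨i | ⟨i, j⟩, rfl⟩ := hz
      · exact ⟨hy i, hb i⟩
      · refine ⟨add_mem (PointedCone.smul_mem _ (ha i) (hy j))
          (PointedCone.smul_mem _ (neg_nonneg.2 (hb j)) (hx i)), le_of_eq ?_⟩
        simp [g]; ring
    | zero => exact ⟨zero_mem _, by simp⟩
    | add u v _ _ hu hv =>
      exact ⟨add_mem hu.1 hv.1, by rw [map_add]; linarith [hu.2, hv.2]⟩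
    | smul c u _ hu =>
      refine ⟨Submodule.smul_mem _ _ hu.1, ?_⟩
      change f ((c : ℝ) • u) ≤ 0
      rw [map_smul]
      exact mul_nonpos_of_nonneg_of_nonpos c.2 hu.2
  · rintro ⟨hz, hfz⟩
    obtain ⟨c, rfl⟩ := (Submodule.mem_span_range_iff_exists_fun _).1 hz
    have hgy : ∀ j, y j ∈ Submodule.span {c : ℝ // 0 ≤ c} (Set.range g) :=
      fun j => Submodule.subset_span ⟨Sum.inl j, rfl⟩
    have hgp : ∀ i j, f (x i) • y j + (-f (y j)) • x i ∈
        Submodule.span {c : ℝ // 0 ≤ c} (Set.range g) :=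
      fun i j => Submodule.subset_span ⟨Sum.inr (i, j), rfl⟩
    have hz' : ∑ i, c i • r i = ∑ i, (c i : ℝ) • x i + ∑ i, (c i : ℝ) • y i := by
      rw [← Finset.sum_add_distrib]
      refine Finset.sum_congr rfl fun i _ => ?_
      rw [← smul_add, ← hxy]; rfl
    rw [hz'] at hfz ⊢
    rw [map_add, map_sum, map_sum] at hfz
    simp only [map_smul, smul_eq_mul] at hfz
    have hP : ∀ i ∈ Finset.univ, 0 ≤ (c i : ℝ) * f (x i) :=
      fun i _ => mul_nonneg (c i).2 (ha i)
    have hP0 := Finset.sum_nonneg hP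
    set P := ∑ i, (c i : ℝ) * f (x i) with hPdef
    set N := ∑ i, (c i : ℝ) * f (y i) with hNdef
    by_cases hN : N = 0
    · have hP1 : P = 0 := by linarith
      have h0 : ∑ i, (c i : ℝ) • x i = 0 := by
        refine Finset.sum_eq_zero fun i hi => ?_
        rcases mul_eq_zero.1 ((Finset.sum_eq_zero_iff_of_nonneg hP).1 hP1 i hi) with h | h
        · rw [h, zero_smul]
        · rw [ha0 i h, smul_zero]
      rw [h0, zero_add]
      exact sum_mem fun j _ => PointedCone.smul_mem _ (c j).2 (hgy j)
    · have hN' : N < 0 := lt_of_le_of_ne (by linarith) hN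
      have e1 : ∑ i, ∑ j, ((c i : ℝ) * c j * (-N)⁻¹) •
          (f (x i) • y j + (-f (y j)) • x i) =
          (P * (-N)⁻¹) • ∑ j, (c j : ℝ) • y j + ∑ i, (c i : ℝ) • x i := by
        simp only [smul_add, Finset.sum_add_distrib]
        congr 1
        · rw [hPdef, Finset.sum_mul, Finset.sum_smul]
          refine Finset.sum_congr rfl fun i _ => ?_
          rw [Finset.smul_sum]
          refine Finset.sum_congr rfl fun j _ => ?_
          simp only [smul_smul]; congr 1; ring
        · refine Finset.sum_congr rfl fun i _ => ?_
          simp only [smul_smul]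
          rw [← Finset.sum_smul]
          congr 1
          have : ∀ j, (c i : ℝ) * c j * (-N)⁻¹ * (-f (y j)) =
              (c i * N⁻¹) * (c j * f (y j)) := by
            intro j; rw [inv_neg]; ring
          simp only [this]
          rw [← Finset.mul_sum, ← hNdef, mul_assoc, inv_mul_cancel₀ hN, mul_one]
      have e2 : ∑ i, (c i : ℝ) • x i + ∑ j, (c j : ℝ) • y j =
          ∑ i, ∑ j, ((c i : ℝ) * c j * (-N)⁻¹) • (f (x i) • y j + (-f (y j)) • x i)
          + (1 - P * (-N)⁻¹) • ∑ j, (c j : ℝ) • y j := by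
        rw [e1, sub_smul, one_smul]; abel
      have hN2 : 0 < -N := by linarith
      rw [e2]
      refine add_mem (sum_mem fun i _ => sum_mem fun j _ =>
        PointedCone.smul_mem _ ?_ (hgp i j)) (PointedCone.smul_mem _ ?_
        (sum_mem fun j _ => PointedCone.smul_mem _ (c j).2 (hgy j)))
      · exact mul_nonneg (mul_nonneg (c i).2 (c j).2) (inv_nonneg.2 hN2.le)
      · rw [← div_eq_mul_inv, sub_nonneg, div_le_one hN2]; linarith

theorem mw_top (d : ℕ) : (⊤ : PointedCone ℝ (Fin d → ℝ)).FG := by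
  classical
  let g : Fin d ⊕ Fin d → (Fin d → ℝ) :=
    Sum.elim (fun i => Pi.single i 1) (fun i => -Pi.single i 1)
  have : Submodule.span {c : ℝ // 0 ≤ c} (Set.range g) = ⊤ := by
    refine eq_top_iff.2 fun z _ => ?_
    rw [pi_eq_sum_univ' z]
    refine sum_mem fun i _ => ?_
    have e : (fun j => if i = j then (1 : ℝ) else 0) = Pi.single i 1 := by
      ext j; simp [Pi.single_apply, eq_comm]
    rcases le_total 0 (z i) with h | h
    · refine PointedCone.smul_mem _ h (Submodule.subset_span ⟨Sum.inl i, ?_⟩)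
      ext j; simp [g, Pi.single_apply, eq_comm]
    · rw [← neg_smul_neg]
      refine PointedCone.smul_mem _ (neg_nonneg.2 h) (Submodule.subset_span ⟨Sum.inr i, ?_⟩)
      ext j; simp [g, Pi.single_apply, eq_comm]
  rw [← this]
  exact Submodule.fg_span (Set.finite_range g)

theorem mw_fin (m d : ℕ) (A : Matrix (Fin m) (Fin d) ℝ) (t : Finset (Fin m)) :
    ∃ K : PointedCone ℝ (Fin d → ℝ), K.FG ∧ ∀ z, z ∈ K ↔ ∀ i ∈ t, (A.mulVec z) i ≤ 0 := by
  classical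
  induction t using Finset.induction_on with
  | empty => exact ⟨⊤, mw_top d, by simp⟩
  | insert a t _ ih =>
    obtain ⟨K, hK, h⟩ := ih
    obtain ⟨L, hL, h'⟩ := mw_step ((LinearMap.proj a).comp A.mulVecLin) K hK
    refine ⟨L, hL, fun z => ?_⟩
    rw [h', h, Finset.forall_mem_insert, and_comm]
    rfl

/-- Homogeneous Minkowski–Weyl, H-representation to V-representation:
every polyhedral cone `{z | A z ≤ 0}` is the set of conical combinations of
finitely many rays. -/
theorem minkowski_weyl_homogeneous_H_to_V (m d : ℕ) (A : Matrix (Fin m) (Fin d) ℝ) :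
    ∃ (s : ℕ) (r : Fin s → (Fin d → ℝ)),
      {z : Fin d → ℝ | A.mulVec z ≤ 0} =
        {z : Fin d → ℝ | ∃ mu : Fin s → ℝ, (∀ j, 0 ≤ mu j) ∧ z = ∑ j, mu j • r j} := by
  obtain ⟨K, hK, h⟩ := mw_fin m d A Finset.univ
  obtain ⟨n, r, rfl⟩ := Submodule.fg_iff_exists_fin_generating_family.1 hK
  refine ⟨n, r, Set.ext fun z => ?_⟩
  have h1 : z ∈ {z : Fin d → ℝ | A.mulVec z ≤ 0} ↔ ∀ i ∈ Finset.univ, (A.mulVec z) i ≤ 0 := by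
    simp [Pi.le_def]
  rw [h1, ← h z, Submodule.mem_span_range_iff_exists_fun]
  constructor
  · rintro ⟨c, rfl⟩
    exact ⟨fun j => c j, fun j => (c j).2, rfl⟩
  · rintro ⟨mu, hmu, rfl⟩
    exact ⟨fun j => ⟨mu j, hmu j⟩, rfl⟩
end

section
/- Let r_1,…,r_s ∈ ℝ^d be finitely many rays. Then there exist an m ∈ ℕ and a real m×d matrix A such that cone(r_1,…,r_s), the set of all conical combinations Σ_j μ_j r_j with μ_j ≥ 0, equals { z ∈ ℝ^d | A z ≤ 0 }. -/
/-- One Fourier–Motzkin elimination step. -/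
lemma fm_step {d : ℕ} (S : Finset (Fin d → ℝ)) (r : Fin d → ℝ) :
    ∃ S' : Finset (Fin d → ℝ), ∀ z : Fin d → ℝ,
      (∃ t : ℝ, 0 ≤ t ∧ ∀ a ∈ S, a ⬝ᵥ (z - t • r) ≤ 0) ↔ ∀ a ∈ S', a ⬝ᵥ z ≤ 0 := by
  classical
  refine ⟨S.filter (fun a => a ⬝ᵥ r ≤ 0) ∪
    ((S.filter (fun a => 0 < a ⬝ᵥ r)) ×ˢ (S.filter (fun a => a ⬝ᵥ r < 0))).image
      (fun q => (q.1 ⬝ᵥ r) • q.2 - (q.2 ⬝ᵥ r) • q.1), fun z => ?_⟩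
  simp only [dotProduct_sub, dotProduct_smul, smul_eq_mul]
  constructor
  · rintro ⟨t, ht, h⟩ a ha
    rcases Finset.mem_union.1 ha with ha | ha
    · obtain ⟨haS, har⟩ := Finset.mem_filter.1 ha
      have := h a haS
      nlinarith
    · obtain ⟨⟨p, n⟩, hq, rfl⟩ := Finset.mem_image.1 ha
      obtain ⟨hp, hn⟩ := Finset.mem_product.1 hq
      obtain ⟨hpS, hpr⟩ := Finset.mem_filter.1 hp
      obtain ⟨hnS, hnr⟩ := Finset.mem_filter.1 hn
      have h1 := h p hpS
      have h2 := h n hnS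
      simp only [sub_dotProduct, smul_dotProduct, smul_eq_mul] at *
      nlinarith [mul_nonneg hpr.le (sub_nonneg.2 h2), mul_nonneg (neg_nonneg.2 hnr.le) (sub_nonneg.2 h1)]
  · intro h
    obtain ⟨t, htT, hmax⟩ := Finset.exists_max_image
      (insert (0 : ℝ) ((S.filter (fun a => 0 < a ⬝ᵥ r)).image (fun a => a ⬝ᵥ z / a ⬝ᵥ r))) id
      (Finset.insert_nonempty _ _)
    refine ⟨t, hmax 0 (Finset.mem_insert_self _ _), fun a ha => ?_⟩
    rcases lt_or_ge 0 (a ⬝ᵥ r) with har | har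
    · have := hmax (a ⬝ᵥ z / a ⬝ᵥ r) (Finset.mem_insert_of_mem
        (Finset.mem_image_of_mem _ (Finset.mem_filter.2 ⟨ha, har⟩)))
      simp only [id] at this
      rw [div_le_iff₀ har] at this
      linarith
    · have h0 := h a (Finset.mem_union_left _ (Finset.mem_filter.2 ⟨ha, har⟩))
      rcases Finset.mem_insert.1 htT with rfl | ht
      · simpa using h0
      · obtain ⟨p, hp, rfl⟩ := Finset.mem_image.1 ht
        have hpr := (Finset.mem_filter.1 hp).2
        rcases har.lt_or_eq with har | har
        · have h1 := h _ (Finset.mem_union_right _ (Finset.mem_image_of_mem _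
            (Finset.mk_mem_product hp (Finset.mem_filter.2 ⟨ha, har⟩))))
          simp only [sub_dotProduct, smul_dotProduct, smul_eq_mul] at h1
          rw [div_mul_eq_mul_div, sub_nonpos, le_div_iff₀ hpr]
          linarith
        · rw [har]; simpa using h0

lemma cone_finset {d : ℕ} (s : ℕ) (r : Fin s → (Fin d → ℝ)) :
    ∃ S : Finset (Fin d → ℝ), ∀ z : Fin d → ℝ,
      (∃ mu : Fin s → ℝ, (∀ j, 0 ≤ mu j) ∧ z = ∑ j, mu j • r j) ↔ ∀ a ∈ S, a ⬝ᵥ z ≤ 0 := by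
  classical
  induction s with
  | zero =>
    refine ⟨Finset.univ.image (fun i : Fin d => Pi.single i (1 : ℝ)) ∪
      Finset.univ.image (fun i : Fin d => Pi.single i (-1 : ℝ)), fun z => ?_⟩
    constructor
    · rintro ⟨mu, -, rfl⟩
      simp
    · intro h
      refine ⟨0, by simp, ?_⟩
      funext i
      have h1 := h _ (Finset.mem_union_left _ (Finset.mem_image_of_mem _ (Finset.mem_univ i)))
      have h2 := h _ (Finset.mem_union_right _ (Finset.mem_image_of_mem _ (Finset.mem_univ i)))
      simp only [single_dotProduct] at h1 h2
      simp
      linarith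
  | succ s ih =>
    obtain ⟨S, hS⟩ := ih (fun j => r j.succ)
    obtain ⟨S', hS'⟩ := fm_step S (r 0)
    refine ⟨S', fun z => ?_⟩
    rw [← hS']
    constructor
    · rintro ⟨mu, hmu, rfl⟩
      refine ⟨mu 0, hmu 0, (hS _).1 ⟨fun j => mu j.succ, fun j => hmu _, ?_⟩⟩
      rw [Fin.sum_univ_succ]; simp
    · rintro ⟨t, ht, h⟩
      obtain ⟨mu, hmu, hz⟩ := (hS _).2 h
      refine ⟨Fin.cons t mu, fun j => ?_, ?_⟩
      · refine Fin.cases ?_ (fun j => ?_) j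
        · simpa using ht
        · simpa using hmu j
      · rw [Fin.sum_univ_succ]
        simp only [Fin.cons_zero, Fin.cons_succ]
        rw [← hz]; simp

/-- Homogeneous Minkowski–Weyl, V-representation to H-representation:
the set of conical combinations of finitely many rays is a polyhedral cone
`{z | A z ≤ 0}`. -/
theorem minkowski_weyl_homogeneous_V_to_H (d s : ℕ) (r : Fin s → (Fin d → ℝ)) :
    ∃ (m : ℕ) (A : Matrix (Fin m) (Fin d) ℝ),
      {z : Fin d → ℝ | ∃ mu : Fin s → ℝ, (∀ j, 0 ≤ mu j) ∧ z = ∑ j, mu j • r j} =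
        {z : Fin d → ℝ | A.mulVec z ≤ 0} := by
  obtain ⟨S, hS⟩ := cone_finset s r
  refine ⟨S.card, Matrix.of (fun i => (S.equivFin.symm i : Fin d → ℝ)), ?_⟩
  ext z
  rw [Set.mem_ofPred_eq, Set.mem_ofPred_eq, hS]
  constructor
  · intro h i
    exact h _ (S.equivFin.symm i).2
  · intro h a ha
    have := h (S.equivFin ⟨a, ha⟩)
    simpa [Matrix.mulVec] using this
end
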